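/- Let P ∈ ℤ[x] be monic and irreducible of even degree 2n ≥ 2, and assume P is primitive, i.e. P cannot be written as Q(x^k) for any integer k ≥ 2 and any Q ∈ ℤ[x]. Then P has no purely imaginary zero: P(iy) ≠ 0 for every y ∈ ℝ. -/

import Mathlib

open Polynomial

/-- An integer polynomial that is even as a function of `X` is a polynomial in `X ^ 2`. -/
theorem eq_comp_X_sq_of_comp_neg_X {P : Polynomial ℤ} (h : P.comp (-X) = P) :
    P = (contract 2 P).comp (X ^ 2) := by
  rw [← expand_eq_comp_X_pow]
  ext m
  rw [coeff_expand two_pos]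
  split_ifs with hm
  · rw [coeff_contract two_ne_zero, Nat.div_mul_cancel hm]
  · have hc := congrArg (fun q => coeff q m) h
    rw [show (-X : Polynomial ℤ) = C (-1) * X by simp] at hc
    simp only [comp_C_mul_X_coeff] at hc
    rw [Odd.neg_one_pow (Nat.not_even_iff_odd.mp fun h => hm h.two_dvd)] at hc
    lia

/-- A monic irreducible integer polynomial with a root in `ℂ` divides every integer polynomial
sharing that root. -/
theorem dvd_of_aeval_eq_zero {P R : Polynomial ℤ} (hmonic : P.Monic) (hirr : Irreducible P)
    {z : ℂ} (hP : aeval z P = 0) (hR : aeval z R = 0) : P ∣ R := by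
  have hz : IsIntegral ℤ z := ⟨P, hmonic, hP⟩
  have hdvd := minpoly.isIntegrallyClosed_dvd hz hP
  have hassoc := (minpoly.irreducible hz).associated_of_dvd hirr hdvd
  exact hassoc.symm.dvd.trans (minpoly.isIntegrallyClosed_dvd hz hR)

theorem stmt3 (n : ℕ) (hn : 1 ≤ n) (P : Polynomial ℤ) (hmonic : P.Monic)
    (hirr : Irreducible P) (hdeg : P.natDegree = 2 * n)
    (hprim : ¬ ∃ (k : ℕ) (Q : Polynomial ℤ), 2 ≤ k ∧ P = Q.comp (X ^ k)) :
    ∀ y : ℝ, Polynomial.aeval ((y : ℂ) * Complex.I) P ≠ 0 := by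
  intro y hy
  have hneg : aeval ((y : ℂ) * Complex.I) (P.comp (-X)) = 0 := by
    have hconj := aeval_algHom_apply (Complex.conjAe.toAlgHom.restrictScalars ℤ)
      ((y : ℂ) * Complex.I) P
    rw [hy, map_zero] at hconj
    simpa [aeval_comp] using hconj
  have hmonic' : (P.comp (-X)).Monic := by
    rw [Monic, comp_neg_X_leadingCoeff_eq, hdeg, hmonic.leadingCoeff]
    simp
  have heven : P.comp (-X) = P :=
    eq_of_monic_of_dvd_of_natDegree_le hmonic hmonic'
      (dvd_of_aeval_eq_zero hmonic hirr hy hneg) (by simp [natDegree_comp])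
  exact hprim ⟨2, contract 2 P, le_rfl, eq_comp_X_sq_of_comp_neg_X heven⟩
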